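/- Assume q ≥ m and let α ∈ Z^m with ℓ(D_α) > 0. Suppose that for each β ∈ Γ̂_Q(α) a function f_β ∈ R_Q with (−v_{Q_1}(f_β), ..., −v_{Q_m}(f_β)) = β is chosen, and that none of the chosen functions f_β has a zero at any point of X outside {Q_1, ..., Q_m}. Then the floor of D_α equals its supported floor: ⌊D_α⌋ = ⌊D_α⌋_Q. -/

import Mathlib

open scoped Classical

/-- Abstract divisor-theoretic data of a nonsingular, projective, geometrically
irreducible algebraic curve over a field `Fq`: a function field `K`, a set of
closed points with their degrees, a genus, and the normalized discrete
valuations of `K` at the closed points (with the junk convention `v P 0 = 0`). -/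
structure Curve (Fq : Type) [Field Fq] where
  /-- the function field of the curve -/
  K : Type
  [fieldK : Field K]
  [algebraK : Algebra Fq K]
  /-- the closed points of the curve -/
  Point : Type
  /-- the degree of a closed point -/
  deg : Point → ℕ
  deg_pos : ∀ P, 0 < deg P
  /-- the genus of the curve -/
  genus : ℕ
  /-- the normalized discrete valuation at a closed point -/
  v : Point → K → ℤ
  v_zero : ∀ P, v P 0 = 0
  v_mul : ∀ (P : Point) {x y : K}, x ≠ 0 → y ≠ 0 → v P (x * y) = v P x + v P y
  v_min_le_add : ∀ (P : Point) {x y : K}, x ≠ 0 → y ≠ 0 → x + y ≠ 0 →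
    min (v P x) (v P y) ≤ v P (x + y)
  v_algebraMap : ∀ (P : Point) (c : Fq), c ≠ 0 → v P (algebraMap Fq K c) = 0
  v_surjective : ∀ P : Point, ∃ x : K, x ≠ 0 ∧ v P x = 1
  /-- a nonzero function has only finitely many zeros and poles -/
  support_finite : ∀ {x : K}, x ≠ 0 → {P : Point | v P x ≠ 0}.Finite
  /-- a function without poles is constant (the curve is projective and
  geometrically irreducible) -/
  no_pole_constant : ∀ {x : K}, x ≠ 0 → (∀ P, 0 ≤ v P x) → ∃ c : Fq, x = algebraMap Fq K c
  /-- principal divisors have degree zero -/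
  degree_principal : ∀ {x : K}, x ≠ 0 → ∑ᶠ P : Point, (deg P : ℤ) * v P x = 0

attribute [instance] Curve.fieldK Curve.algebraK

namespace Curve

variable {Fq : Type} [Field Fq] [Fintype Fq]

/-- The degree of a divisor. -/
noncomputable def degDiv (C : Curve Fq) (D : C.Point →₀ ℤ) : ℤ :=
  D.sum fun P n => (C.deg P : ℤ) * n

/-- The Riemann–Roch space `L(D)`. -/
def Lset (C : Curve Fq) (D : C.Point →₀ ℤ) : Set C.K :=
  {h | h = 0 ∨ ∀ P : C.Point, 0 ≤ C.v P h + D P}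

/-- `ℓ(D)`, the dimension of `L(D)` as an `Fq`-vector space. -/
noncomputable def ell (C : Curve Fq) (D : C.Point →₀ ℤ) : ℕ :=
  Module.finrank Fq (Submodule.span Fq (C.Lset D))

/-- The divisor `D` is principal. -/
def IsPrincipalDiv (C : Curve Fq) (D : C.Point →₀ ℤ) : Prop :=
  ∃ h : C.K, h ≠ 0 ∧ ∀ P : C.Point, C.v P h = D P

/-- The divisor `D_α = α₁Q₁ + ⋯ + α_mQ_m`. -/
noncomputable def Dt (C : Curve Fq) {m : ℕ} (Q : Fin m → C.Point) (α : Fin m → ℤ) :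
    C.Point →₀ ℤ :=
  ∑ i, Finsupp.single (Q i) (α i)

/-- The generalized Weierstrass semigroup `Ĥ(Q)`: the set of tuples
`(-v_{Q_1}(h), …, -v_{Q_m}(h))` for nonzero `h` having poles only in `{Q_1, …, Q_m}`. -/
def Hhat (C : Curve Fq) {m : ℕ} (Q : Fin m → C.Point) : Set (Fin m → ℤ) :=
  {α | ∃ h : C.K, h ≠ 0 ∧ (∀ P : C.Point, P ∉ Set.range Q → 0 ≤ C.v P h) ∧
    ∀ i, α i = -C.v (Q i) h}

/-- `∇_J(α)`. -/
def nabla (C : Curve Fq) {m : ℕ} (Q : Fin m → C.Point) (J : Set (Fin m))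
    (α : Fin m → ℤ) : Set (Fin m → ℤ) :=
  {β | β ∈ C.Hhat Q ∧ (∀ j ∈ J, β j = α j) ∧ ∀ i ∉ J, β i < α i}

/-- `∇_i^m(α)`. -/
def nablaI (C : Curve Fq) {m : ℕ} (Q : Fin m → C.Point) (i : Fin m) (α : Fin m → ℤ) :
    Set (Fin m → ℤ) :=
  {β | β ∈ C.Hhat Q ∧ β i = α i ∧ ∀ j, j ≠ i → β j ≤ α j}

/-- `Γ̂(Q)`, the set of absolute maximal elements of `Ĥ(Q)`. -/
def Gammahat (C : Curve Fq) {m : ℕ} (Q : Fin m → C.Point) : Set (Fin m → ℤ) :=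
  {α | α ∈ C.Hhat Q ∧
    ∀ J : Set (Fin m), J.Nonempty → J ≠ Set.univ → C.nabla Q J α = ∅}

/-- `Γ̂_Q(α) = {β ∈ Γ̂(Q) : β ≤ α}`. -/
def GammahatLe (C : Curve Fq) {m : ℕ} (Q : Fin m → C.Point) (α : Fin m → ℤ) :
    Set (Fin m → ℤ) :=
  {β | β ∈ C.Gammahat Q ∧ ∀ i, β i ≤ α i}

/-- The divisor `A` is a discrepancy with respect to `P` and `Q'`. -/
def IsDiscrepancy (C : Curve Fq) (A : C.Point →₀ ℤ) (P Q' : C.Point) : Prop :=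
  C.Lset A ≠ C.Lset (A - Finsupp.single Q' 1) ∧
  C.Lset (A - Finsupp.single P 1) = C.Lset (A - Finsupp.single P 1 - Finsupp.single Q' 1)

/-- `T_α = {β ∈ ℤ^m : β ≤ α and ℓ(D_β) = ℓ(D_α)}`. -/
def Tset (C : Curve Fq) {m : ℕ} (Q : Fin m → C.Point) (α : Fin m → ℤ) :
    Set (Fin m → ℤ) :=
  {β | (∀ j, β j ≤ α j) ∧ C.ell (C.Dt Q β) = C.ell (C.Dt Q α)}

/-- `D_β` is the supported floor `⌊D_α⌋_Q`: `β` is the element of `T_α` of minimum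
norm `|β| = β₁ + ⋯ + β_m`. -/
def IsSuppFloor (C : Curve Fq) {m : ℕ} (Q : Fin m → C.Point) (α β : Fin m → ℤ) : Prop :=
  β ∈ C.Tset Q α ∧ ∀ γ ∈ C.Tset Q α, ∑ i, β i ≤ ∑ i, γ i

/-- `G'` is the floor `⌊G⌋` of `G`: among all divisors with the same Riemann–Roch
space as `G`, it has minimum degree. -/
def IsFloorDiv (C : Curve Fq) (G G' : C.Point →₀ ℤ) : Prop :=
  C.Lset G' = C.Lset G ∧
  ∀ G'' : C.Point →₀ ℤ, C.Lset G'' = C.Lset G → C.degDiv G' ≤ C.degDiv G''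

end Curve

namespace Curve

section

variable {Fq : Type} [Field Fq]

theorem Dt_apply (C : Curve Fq) {m : ℕ} {Q : Fin m → C.Point} (hQ : Function.Injective Q)
    (α : Fin m → ℤ) (i : Fin m) : C.Dt Q α (Q i) = α i := by
  simp [Dt, Finsupp.finsetSum_apply, Finsupp.single_apply, hQ.eq_iff]

theorem Dt_apply_of_notMem (C : Curve Fq) {m : ℕ} {Q : Fin m → C.Point}
    (α : Fin m → ℤ) {P : C.Point} (hP : P ∉ Set.range Q) : C.Dt Q α P = 0 := by
  rw [Dt, Finsupp.finsetSum_apply]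
  exact Finset.sum_eq_zero fun i _ => Finsupp.single_eq_of_ne fun h => hP ⟨i, h.symm⟩

/-- The Riemann–Roch space as a subspace of the function field. -/
def Lspace (C : Curve Fq) (D : C.Point →₀ ℤ) : Submodule Fq C.K where
  carrier := C.Lset D
  zero_mem' := Or.inl rfl
  add_mem' := by
    intro x y hx hy
    by_cases hxy : x + y = 0
    · exact Or.inl hxy
    by_cases hx0 : x = 0
    · simpa [hx0] using hy
    by_cases hy0 : y = 0
    · simpa [hy0] using hx
    refine Or.inr fun P => ?_
    have h := C.v_min_le_add P hx0 hy0 hxy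
    have h1 := hx.resolve_left hx0 P
    have h2 := hy.resolve_left hy0 P
    omega
  smul_mem' := by
    intro c x hx
    by_cases hc : c = 0
    · exact Or.inl (by simp [hc])
    by_cases hx0 : x = 0
    · exact Or.inl (by simp [hx0])
    refine Or.inr fun P => ?_
    rw [Algebra.smul_def, C.v_mul P (by simpa using hc) hx0, C.v_algebraMap P c hc]
    simpa using hx.resolve_left hx0 P

theorem ell_eq_finrank (C : Curve Fq) (D : C.Point →₀ ℤ) :
    C.ell D = Module.finrank Fq (C.Lspace D) := by
  have h : Submodule.span Fq (C.Lset D) = C.Lspace D := Submodule.span_eq (C.Lspace D)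
  rw [ell, h]

theorem Lset_mono (C : Curve Fq) {D E : C.Point →₀ ℤ} (h : D ≤ E) : C.Lset D ⊆ C.Lset E := by
  rintro x (hx | hx)
  · exact Or.inl hx
  · exact Or.inr fun P => (hx P).trans (by linarith [h P])

theorem Lset_eq_of_le_of_ell_eq (C : Curve Fq) {D E : C.Point →₀ ℤ} (hle : D ≤ E)
    (hE : 0 < C.ell E) (h : C.ell D = C.ell E) : C.Lset D = C.Lset E := by
  rw [ell_eq_finrank] at hE
  rw [ell_eq_finrank, ell_eq_finrank] at h
  have : FiniteDimensional Fq (C.Lspace E) := Module.finite_of_finrank_pos hE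
  exact congrArg SetLike.coe (Submodule.eq_of_le_of_finrank_eq
    (show C.Lspace D ≤ C.Lspace E from C.Lset_mono hle) h)

theorem exists_ne_zero_mem_Lset (C : Curve Fq) {D : C.Point →₀ ℤ} (h : 0 < C.ell D) :
    ∃ x ∈ C.Lset D, x ≠ 0 := by
  rw [ell_eq_finrank] at h
  have : Nontrivial (C.Lspace D) := Module.nontrivial_of_finrank_pos h
  obtain ⟨x, hx⟩ := exists_ne (0 : C.Lspace D)
  exact ⟨x, x.2, by simpa using hx⟩

theorem Lset_inf (C : Curve Fq) (D E : C.Point →₀ ℤ) :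
    C.Lset (D ⊓ E) = C.Lset D ∩ C.Lset E := by
  refine subset_antisymm
    (Set.subset_inter (C.Lset_mono inf_le_left) (C.Lset_mono inf_le_right)) ?_
  rintro x ⟨hD | hD, hE | hE⟩
  · exact Or.inl hD
  · exact Or.inl hD
  · exact Or.inl hE
  · refine Or.inr fun P => ?_
    have h1 := hD P
    have h2 := hE P
    rw [Finsupp.inf_apply]
    omega

theorem eq_of_le_of_degDiv_le (C : Curve Fq) {D E : C.Point →₀ ℤ} (hle : D ≤ E)
    (h : C.degDiv E ≤ C.degDiv D) : D = E := by
  have hsum : ∀ F : C.Point →₀ ℤ, F.support ⊆ D.support ∪ E.support →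
      C.degDiv F = ∑ P ∈ D.support ∪ E.support, (C.deg P : ℤ) * F P := fun F hF =>
    Finsupp.sum_of_support_subset _ hF _ fun _ _ => mul_zero _
  rw [hsum D Finset.subset_union_left, hsum E Finset.subset_union_right] at h
  have hmul : ∀ P ∈ D.support ∪ E.support, (C.deg P : ℤ) * D P ≤ (C.deg P : ℤ) * E P :=
    fun P _ => mul_le_mul_of_nonneg_left (hle P) (Int.natCast_nonneg _)
  have heq := (Finset.sum_eq_sum_iff_of_le hmul).1 (le_antisymm (Finset.sum_le_sum hmul) h)
  ext P
  by_cases hP : P ∈ D.support ∪ E.support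
  · exact mul_left_cancel₀ (by exact_mod_cast (C.deg_pos P).ne') (heq P hP)
  · simp only [Finset.mem_union, Finsupp.mem_support_iff, not_or, not_not] at hP
    rw [hP.1, hP.2]

theorem IsFloorDiv.le (C : Curve Fq) {G G' D : C.Point →₀ ℤ} (h : C.IsFloorDiv G G')
    (hD : C.Lset D = C.Lset G) : G' ≤ D := by
  have hinf : C.Lset (G' ⊓ D) = C.Lset G := by rw [Lset_inf, h.1, hD, Set.inter_self]
  exact inf_eq_left.1 (C.eq_of_le_of_degDiv_le inf_le_left (h.2 _ hinf))

theorem sum_nonneg_of_mem_Hhat (C : Curve Fq) {m : ℕ} {Q : Fin m → C.Point}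
    (hQinj : Function.Injective Q) (hQdeg : ∀ i, C.deg (Q i) = 1) {β : Fin m → ℤ}
    (hβ : β ∈ C.Hhat Q) : 0 ≤ ∑ i, β i := by
  obtain ⟨h, h0, hreg, hval⟩ := hβ
  have hdeg := C.degree_principal h0
  have hsupp : (Function.support fun P => (C.deg P : ℤ) * C.v P h) ⊆
      ((C.support_finite h0).toFinset ∪ Finset.univ.image Q : Finset C.Point) := by
    intro P hP
    have : C.v P h ≠ 0 := fun h' => hP (by simp [h'])
    simp [this]
  rw [finsum_eq_sum_of_support_subset _ hsupp] at hdeg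
  have hle : ∑ P ∈ Finset.univ.image Q, (C.deg P : ℤ) * C.v P h ≤ 0 := by
    rw [← hdeg]
    refine Finset.sum_le_sum_of_subset_of_nonneg Finset.subset_union_right fun P _ hP => ?_
    exact mul_nonneg (Int.natCast_nonneg _) (hreg P (by simpa using hP))
  rw [Finset.sum_image hQinj.injOn] at hle
  simp only [hQdeg, hval, Finset.sum_neg_distrib, Nat.cast_one, one_mul] at hle ⊢
  linarith

/-- An element of minimal norm among those of `Ĥ(Q)` below `α` is absolute maximal. -/
theorem GammahatLe_nonempty (C : Curve Fq) {m : ℕ} {Q : Fin m → C.Point}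
    (hQinj : Function.Injective Q) (hQdeg : ∀ i, C.deg (Q i) = 1) {α : Fin m → ℤ}
    (hα : 0 < C.ell (C.Dt Q α)) : (C.GammahatLe Q α).Nonempty := by
  have hne : {β | β ∈ C.Hhat Q ∧ ∀ i, β i ≤ α i}.Nonempty := by
    obtain ⟨h, hL, h0⟩ := C.exists_ne_zero_mem_Lset hα
    have hL := hL.resolve_left h0
    refine ⟨fun i => -C.v (Q i) h, ⟨h, h0, fun P hP => ?_, fun i => rfl⟩, fun i => ?_⟩
    · simpa [C.Dt_apply_of_notMem α hP] using hL P
    · have := hL (Q i)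
      rw [C.Dt_apply hQinj] at this
      linarith
  obtain ⟨β, ⟨hβ, hβα⟩, hmin⟩ :=
    (measure fun β : Fin m → ℤ => (∑ i, β i).toNat).wf.has_min _ hne
  refine ⟨β, ⟨hβ, fun J _ hJ => Set.eq_empty_of_forall_notMem ?_⟩, hβα⟩
  rintro δ ⟨hδ, hδJ, hδJ'⟩
  have hle : ∀ i, δ i ≤ β i := fun i =>
    if hi : i ∈ J then (hδJ i hi).le else (hδJ' i hi).le
  obtain ⟨i, hi⟩ := (Set.ne_univ_iff_exists_notMem J).1 hJ
  have hlt : ∑ i, δ i < ∑ i, β i :=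
    Finset.sum_lt_sum (fun i _ => hle i) ⟨i, Finset.mem_univ i, hδJ' i hi⟩
  refine hmin δ ⟨hδ, fun i => (hle i).trans (hβα i)⟩ ?_
  have := C.sum_nonneg_of_mem_Hhat hQinj hQdeg hδ
  show (∑ i, δ i).toNat < (∑ i, β i).toNat
  omega

end

end Curve

/-- Proposition 3.7: assume `q ≥ m` and `ℓ(D_α) > 0`.  If for
each `β ∈ Γ̂_Q(α)` a function `f_β ∈ R_Q` with `ρ(f_β) = β` is chosen, and none of
the `f_β` has a zero outside `{Q_1, …, Q_m}`, then `⌊D_α⌋ = ⌊D_α⌋_Q`. -/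
theorem statement6 {Fq : Type} [Field Fq] [Fintype Fq] (C : Curve Fq)
    (hgenus : 0 < C.genus) (K₀ : C.Point →₀ ℤ)
    (hRR : ∀ D : C.Point →₀ ℤ,
      (C.ell D : ℤ) - C.ell (K₀ - D) = C.degDiv D + 1 - C.genus)
    {m : ℕ} (hm : 2 ≤ m) (Q : Fin m → C.Point)
    (hQinj : Function.Injective Q) (hQdeg : ∀ i, C.deg (Q i) = 1)
    (hq : m ≤ Fintype.card Fq)
    (α : Fin m → ℤ) (hα : 0 < C.ell (C.Dt Q α))
    (f : (Fin m → ℤ) → C.K)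
    (hf : ∀ β ∈ C.GammahatLe Q α, f β ≠ 0 ∧ (∀ i, C.v (Q i) (f β) = -β i) ∧
      ∀ P : C.Point, P ∉ Set.range Q → C.v P (f β) = 0) :
    ∀ (G' : C.Point →₀ ℤ) (γ : Fin m → ℤ),
      C.IsFloorDiv (C.Dt Q α) G' → C.IsSuppFloor Q α γ → G' = C.Dt Q γ := by
  intro G' γ hG hγ
  have hγα : C.Dt Q γ ≤ C.Dt Q α := by
    intro P
    by_cases hP : P ∈ Set.range Q
    · obtain ⟨i, rfl⟩ := hP
      simpa only [C.Dt_apply hQinj] using hγ.1.1 i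
    · rw [C.Dt_apply_of_notMem γ hP, C.Dt_apply_of_notMem α hP]
  have hG'γ : G' ≤ C.Dt Q γ :=
    hG.le C (C.Lset_eq_of_le_of_ell_eq hγα hα hγ.1.2)
  obtain ⟨β, hβ⟩ := C.GammahatLe_nonempty hQinj hQdeg hα
  obtain ⟨hf0, hfQ, hfP⟩ := hf β hβ
  have hfL : f β ∈ C.Lset (C.Dt Q α) := by
    refine Or.inr fun P => ?_
    by_cases hP : P ∈ Set.range Q
    · obtain ⟨i, rfl⟩ := hP
      rw [hfQ, C.Dt_apply hQinj]
      linarith [hβ.2 i]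
    · rw [hfP P hP, C.Dt_apply_of_notMem α hP, add_zero]
  rw [← hG.1] at hfL
  have hG'Dt : G' = C.Dt Q fun i => G' (Q i) := by
    ext P
    by_cases hP : P ∈ Set.range Q
    · obtain ⟨i, rfl⟩ := hP
      rw [C.Dt_apply hQinj]
    · rw [C.Dt_apply_of_notMem _ hP]
      have h1 := hfL.resolve_left hf0 P
      have h2 := hG'γ P
      rw [hfP P hP] at h1
      rw [C.Dt_apply_of_notMem γ hP] at h2
      omega
  have hle : ∀ i, G' (Q i) ≤ γ i := fun i => by
    simpa only [C.Dt_apply hQinj] using hG'γ (Q i)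
  have hT : (fun i => G' (Q i)) ∈ C.Tset Q α := by
    refine ⟨fun i => (hle i).trans (hγ.1.1 i), ?_⟩
    rw [← hG'Dt, Curve.ell, Curve.ell, hG.1]
  have heq := (Finset.sum_eq_sum_iff_of_le fun i _ => hle i).1
    (le_antisymm (Finset.sum_le_sum fun i _ => hle i) (hγ.2 _ hT))
  rw [hG'Dt]
  exact congrArg (C.Dt Q) (funext fun i => heq i (Finset.mem_univ i))
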